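/- Let q be a periodic twinless path 1-CQ and Q = (cov_A, q). Then every cactus in K_Q^min has branching number at most 1. -/

import Mathlib

attribute [local instance] Classical.propDecidable

namespace DS

/-- Ground/query atoms over binary-predicate alphabet `σ` and node type `α`:
unary predicates `F`, `T`, `A` and binary predicates `R r`. -/
inductive At (σ α : Type) : Type
  | F : α → At σ α
  | T : α → At σ α
  | A : α → At σ α
  | R : σ → α → α → At σ α

namespace At

/-- Renaming of the nodes of an atom. -/
def map {σ α β : Type} (h : α → β) : At σ α → At σ β
  | .F a => .F (h a)
  | .T a => .T (h a)
  | .A a => .A (h a)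
  | .R r a b => .R r (h a) (h b)

/-- The nodes occurring in an atom. -/
def vars {σ α : Type} : At σ α → Set α
  | .F a => {a}
  | .T a => {a}
  | .A a => {a}
  | .R _ a b => {a, b}

end At

/-- An interpretation over domain `δ`. -/
structure Interp (σ δ : Type) where
  FS : δ → Prop
  TS : δ → Prop
  AS : δ → Prop
  RS : σ → δ → δ → Prop

/-- Truth of an atom in an interpretation. -/
def Interp.satAt {σ δ : Type} (I : Interp σ δ) : At σ δ → Prop
  | .F a => I.FS a
  | .T a => I.TS a
  | .A a => I.AS a
  | .R r a b => I.RS r a b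

/-- `I ⊨ q`: there is a homomorphism from the Boolean CQ `q` into `I`. -/
def Interp.satCQ {σ δ V : Type} (I : Interp σ δ) (q : Set (At σ V)) : Prop :=
  ∃ h : V → δ, ∀ a ∈ q, I.satAt (At.map h a)

/-- An ABox viewed as an interpretation over its own individuals. -/
def toInterp {σ α : Type} (A : Set (At σ α)) : Interp σ α where
  FS a := At.F a ∈ A
  TS a := At.T a ∈ A
  AS a := At.A a ∈ A
  RS r a b := At.R r a b ∈ A

/-- An individual is undecided if it is labelled `A` but neither `F` nor `T`. -/
def undecided {σ α : Type} (A : Set (At σ α)) (a : α) : Prop :=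
  At.A a ∈ A ∧ At.F a ∉ A ∧ At.T a ∉ A

/-- The minimal model of `cov_A` and the ABox `A` determined by a choice `c` of
one of `F`/`T` for each undecided `A`-individual. -/
def minModel {σ α : Type} (A : Set (At σ α)) (c : α → Bool) : Interp σ α where
  FS a := At.F a ∈ A ∨ (undecided A a ∧ c a = true)
  TS a := At.T a ∈ A ∨ (undecided A a ∧ c a = false)
  AS a := At.A a ∈ A
  RS r a b := At.R r a b ∈ A

/-- `F` and `T` are interpreted disjointly. -/
def disjointFT {σ δ : Type} (I : Interp σ δ) : Prop := ∀ d : δ, ¬ (I.FS d ∧ I.TS d)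

/-- Certain answer to the OMQ `(cov_A, q)` over the ABox `A`:
`q` holds in every minimal model of `cov_A` and `A`. -/
def covACert {σ α V : Type} (A : Set (At σ α)) (q : Set (At σ V)) : Prop :=
  ∀ c : α → Bool, (minModel A c).satCQ q

/-- Certain answer to the OMQ `(cov_A^⊥, q)` over the ABox `A`:
`q` holds in every minimal model of `cov_A^⊥` and `A` (the minimal models of
`cov_A` in which `F` and `T` are disjoint). -/
def covABotCert {σ α V : Type} (A : Set (At σ α)) (q : Set (At σ V)) : Prop :=
  ∀ c : α → Bool, disjointFT (minModel A c) → (minModel A c).satCQ q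

/-- No `FT`-twin occurs. -/
def twinFree {σ α : Type} (A : Set (At σ α)) : Prop :=
  ∀ a : α, ¬ (At.F a ∈ A ∧ At.T a ∈ A)

/-- A CQ does not use the unary predicate `A`. -/
def noA {σ V : Type} (q : Set (At σ V)) : Prop := ∀ v : V, At.A v ∉ q

/-- `x` occurs in `q`. -/
def occ {σ V : Type} (q : Set (At σ V)) (x : V) : Prop := ∃ a ∈ q, x ∈ At.vars a

/-- Connectedness of a CQ. -/
def connCQ {σ V : Type} (q : Set (At σ V)) : Prop :=
  ∀ x y : V, occ q x → occ q y →
    Relation.ReflTransGen (fun u v => ∃ a ∈ q, u ∈ At.vars a ∧ v ∈ At.vars a) x y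

/-- Solitary `F`-node of a CQ. -/
def solF {σ V : Type} (q : Set (At σ V)) (x : V) : Prop := At.F x ∈ q ∧ At.T x ∉ q

/-- Solitary `T`-node of a CQ. -/
def solT {σ V : Type} (q : Set (At σ V)) (y : V) : Prop := At.T y ∈ q ∧ At.F y ∉ q
/-- The path CQ with `m` edges labelled `ρ 0, …, ρ (m-1)` along the nodes
`0, 1, …, m`, whose `F`-nodes are the elements of `FL` and whose `T`-nodes are
the elements of `TL`. -/
def pathCQ (σ : Type) (m : ℕ) (ρ : ℕ → σ) (FL TL : Set ℕ) : Set (At σ ℕ) :=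
  {a | (∃ i, i < m ∧ a = At.R (ρ i) i (i + 1)) ∨
       (∃ i ∈ FL, a = At.F i) ∨ (∃ i ∈ TL, a = At.T i)}
/-- A twinless path `1`-CQ `q = q_{0r}` (single `F`-node `x0`, all `T`-nodes
after it) is right-periodic: either `r = 1`, or the `T`-nodes succeeding `x0`
are `x0 + p, x0 + 2p, …, x0 + r·p` for some period `p` and the word of edge
labels is periodic with period `p` from `x0` onwards (which encodes
`r_1 = … = r_r` and `r_{r+1} = (r_1)^k λ` for a prefix `λ` of `r_1`). -/
def rightPeriodic (σ : Type) (m x0 : ℕ) (ρ : ℕ → σ) (TL : Set ℕ) : Prop :=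
  (∀ t ∈ TL, x0 < t) ∧
  (TL.ncard = 1 ∨
    ∃ p, 0 < p ∧ TL = {x | ∃ k, 1 ≤ k ∧ k ≤ TL.ncard ∧ x = x0 + k * p} ∧
      ∀ i, x0 ≤ i → i + p < m → ρ (i + p) = ρ i)

/-- The mirror image of `rightPeriodic`: all `T`-nodes precede the single
`F`-node `x0` and the labels are periodic towards the left end. -/
def leftPeriodic (σ : Type) (m x0 : ℕ) (ρ : ℕ → σ) (TL : Set ℕ) : Prop :=
  (∀ t ∈ TL, t < x0) ∧
  (TL.ncard = 1 ∨
    ∃ p, 0 < p ∧ TL = {x | ∃ k, 1 ≤ k ∧ k ≤ TL.ncard ∧ x + k * p = x0} ∧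
      ∀ i, i + p < x0 → ρ (i + p) = ρ i)
/-- The class `K_Q^+` of cactuses for `Q = (cov_A, q)` (`q` a `1`-CQ over the
variables `ℕ` with unique solitary `F`-node `x`), together with bookkeeping
data: the skeleton `S` (the set of addresses of segments, an address being the
list of budded nodes leading to the segment), the segment address `seg v` of
each node `v`, and the set `tc` of `T`-copies (copies of solitary `T`-nodes of
`q`).  Rule `bud` is budding; rule `prune` removes a solitary `T(y)` provided
the result still entails `q` under `cov_A` (the skeleton is unchanged). -/
inductive CacP {σ : Type} (q : Set (At σ ℕ)) (x : ℕ) :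
    Set (At σ ℕ) → Set (List ℕ) → (ℕ → List ℕ) → Set ℕ → Prop
  | base : CacP q x q {[]} (fun _ => []) {v | solT q v}
  | bud (C : Set (At σ ℕ)) (S : Set (List ℕ)) (seg : ℕ → List ℕ) (tc : Set ℕ)
      (hC : CacP q x C S seg tc) (y : ℕ)
      (hyT : At.T y ∈ C) (hyF : At.F y ∉ C)
      (ρ : ℕ → ℕ) (hinj : Function.Injective ρ) (hρx : ρ x = y)
      (hfresh : ∀ v : ℕ, v ≠ x → ¬ occ C (ρ v)) :
      CacP q x ((C \ {At.T y}) ∪ At.map ρ '' (insert (At.A x) (q \ {At.F x})))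
        (insert (seg y ++ [y]) S)
        (fun v => if v ∈ Set.range ρ ∧ v ≠ y then seg y ++ [y] else seg v)
        (tc ∪ ρ '' {v | solT q v})
  | prune (C : Set (At σ ℕ)) (S : Set (List ℕ)) (seg : ℕ → List ℕ) (tc : Set ℕ)
      (hC : CacP q x C S seg tc) (y : ℕ)
      (hyT : At.T y ∈ C) (hyF : At.F y ∉ C)
      (hent : covACert (C \ {At.T y}) q) :
      CacP q x (C \ {At.T y}) S seg tc

/-- `s` and `t` are incomparable nodes of a skeleton (neither is an ancestor,
i.e. a prefix, of the other). -/
def incomp (s t : List ℕ) : Prop := ¬ s <+: t ∧ ¬ t <+: s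

/-- The full binary tree of depth `d` is a minor of the skeleton `S`: there is a
topological embedding sending each node of the binary tree (a `Bool`-word of
length at most `d`) to a node of `S`, children to strict descendants, and the
two children of a node to incomparable nodes. -/
def binMinor (S : Set (List ℕ)) (d : ℕ) : Prop :=
  ∃ e : List Bool → List ℕ,
    (∀ l : List Bool, l.length ≤ d → e l ∈ S) ∧
    (∀ (l : List Bool) (b : Bool), l.length < d →
      e l <+: e (l ++ [b]) ∧ e l ≠ e (l ++ [b])) ∧
    (∀ l : List Bool, l.length < d → incomp (e (l ++ [true])) (e (l ++ [false])))

/-- The branching number of the skeleton `S` is at most `n`: the largest full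
binary tree that is a minor of `S` has depth at most `n`. -/
def brLE (S : Set (List ℕ)) (n : ℕ) : Prop := ¬ binMinor S (n + 1)

/-- Directed edge atom, with a global orientation flag. -/
def Ed {σ : Type} (d : Bool) (s : σ) (a b : ℕ) : At σ ℕ := if d = true then At.R s a b else At.R s b a

section Core
variable {σ : Type} (d : Bool) (m X : ℕ) (lab : ℕ → σ) (TL : Set ℕ) (n : ℕ → ℕ)

theorem Ed_map (h : ℕ → ℕ) (s : σ) (a b : ℕ) : At.map h (Ed d s a b) = Ed d s (h a) (h b) := by
  cases d <;> simp [Ed, At.map]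

theorem Ed_inj (s s' : σ) (a b a' b' : ℕ) :
    Ed d s a b = Ed d s' a' b' ↔ s = s' ∧ a = a' ∧ b = b' := by
  cases d <;> simp [Ed] <;> tauto

theorem Ed_ne_F (s : σ) (a b v : ℕ) : Ed d s a b ≠ At.F v := by cases d <;> simp [Ed]
theorem Ed_ne_T (s : σ) (a b v : ℕ) : Ed d s a b ≠ At.T v := by cases d <;> simp [Ed]
theorem Ed_ne_A (s : σ) (a b v : ℕ) : Ed d s a b ≠ At.A v := by cases d <;> simp [Ed]

theorem Ed_sat (A : Set (At σ ℕ)) (c : ℕ → Bool) (s : σ) (a b : ℕ) :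
    (minModel A c).satAt (Ed d s a b) ↔ Ed d s a b ∈ A := by
  cases d <;> simp [Ed, Interp.satAt, minModel]

theorem Ed_vars (s : σ) (a b : ℕ) : a ∈ At.vars (Ed d s a b) ∧ b ∈ At.vars (Ed d s a b) := by
  cases d <;> simp [Ed, At.vars]

/-- Oriented path query. -/
def gq : Set (At σ ℕ) :=
  {a | (∃ i, i < m ∧ a = Ed d (lab i) (n i) (n (i + 1))) ∨ a = At.F (n X) ∨
    (∃ t ∈ TL, a = At.T (n t))}

/-- Bud history: the list of the copies (index to name), most recent first. -/
inductive Hist : List (ℕ → ℕ) → Prop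
  | nil : Hist []
  | cons (L : List (ℕ → ℕ)) (g : ℕ → ℕ) (hL : Hist L) (hinj : Function.Injective g)
      (hpar : ∃ g' ∈ n :: L, ∃ t ∈ TL, g X = g' t)
      (hnew : ∀ g' ∈ L, g' X ≠ g X)
      (hfr : ∀ v, v ≠ X → ∀ g' ∈ n :: L, ∀ i, i ≤ m → g v ≠ g' i) : Hist (g :: L)

/-- Nodes of the unpruned cactus labelled `T`. -/
def TN (L : List (ℕ → ℕ)) : Set ℕ :=
  {v | (∃ g ∈ n :: L, ∃ t ∈ TL, v = g t) ∧ ∀ g ∈ L, g X ≠ v}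

/-- Cactus with history `L` and set `U` of `T` nodes. -/
def cact (L : List (ℕ → ℕ)) (U : Set ℕ) : Set (At σ ℕ) :=
  {a | (∃ g ∈ n :: L, ∃ i, i < m ∧ a = Ed d (lab i) (g i) (g (i + 1))) ∨ a = At.F (n X) ∨
    (∃ g ∈ L, a = At.A (g X)) ∨ (∃ v ∈ U, a = At.T v)}

/-- Edge of the cactus. -/
def edge (L : List (ℕ → ℕ)) (s : σ) (a b : ℕ) : Prop :=
  ∃ g ∈ n :: L, ∃ j, j < m ∧ s = lab j ∧ a = g j ∧ b = g (j + 1)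

/-- Truth of `T`. -/
def TT (L : List (ℕ → ℕ)) (U : Set ℕ) (c : ℕ → Bool) (v : ℕ) : Prop :=
  v ∈ U ∨ ((∃ g ∈ L, v = g X) ∧ c v = false)

/-- Truth of `F`. -/
def FF (L : List (ℕ → ℕ)) (c : ℕ → Bool) (v : ℕ) : Prop :=
  v = n X ∨ ((∃ g ∈ L, v = g X) ∧ c v = true)

/-- The query holds in the model given by `c`. -/
def MM (L : List (ℕ → ℕ)) (U : Set ℕ) (c : ℕ → Bool) : Prop :=
  ∃ g : ℕ → ℕ, FF X n L c (g X) ∧ (∀ t ∈ TL, TT X L U c (g t)) ∧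
    ∀ i, i < m → edge m lab n L (lab i) (g i) (g (i + 1))

variable {d m X lab TL n}

theorem mem_cact_Ed {L U s a b} : Ed d s a b ∈ cact d m X lab n L U ↔ edge m lab n L s a b := by
  constructor
  · rintro (⟨g, hg, i, hi, h⟩ | h | ⟨g, hg, h⟩ | ⟨v, hv, h⟩)
    · rw [Ed_inj] at h; exact ⟨g, hg, i, hi, h⟩
    · exact absurd h (Ed_ne_F _ _ _ _ _)
    · exact absurd h (Ed_ne_A _ _ _ _ _)
    · exact absurd h (Ed_ne_T _ _ _ _ _)
  · rintro ⟨g, hg, i, hi, h⟩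
    exact Or.inl ⟨g, hg, i, hi, by rw [Ed_inj]; exact h⟩

theorem mem_cact_F {L U v} : At.F v ∈ cact d m X lab n L U ↔ v = n X := by
  simp only [cact, Set.mem_ofPred_eq, (Ed_ne_F _ _ _ _ _).symm]; simp

theorem mem_cact_T {L U v} : At.T v ∈ cact d m X lab n L U ↔ v ∈ U := by
  simp only [cact, Set.mem_ofPred_eq, (Ed_ne_T _ _ _ _ _).symm]; simp

theorem mem_cact_A {L U v} : At.A v ∈ cact d m X lab n L U ↔ ∃ g ∈ L, v = g X := by
  simp only [cact, Set.mem_ofPred_eq, (Ed_ne_A _ _ _ _ _).symm]; simp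

theorem Hist.inj {L} (h : Hist m X TL n L) : ∀ g ∈ L, Function.Injective g := by
  induction h with
  | nil => simp
  | cons L g hL hinj _ _ _ ih =>
    intro g' hg'
    rcases List.mem_cons.1 hg' with rfl | h
    · exact hinj
    · exact ih _ h

theorem Hist.notmem {L} (hm : 0 < m) (h : Hist m X TL n L) : n ∉ L := by
  induction h with
  | nil => simp
  | cons L g hL hinj _ _ hfr ih =>
    intro h
    rcases List.mem_cons.1 h with rfl | h
    · by_cases h0 : X = 0
      · exact hfr 1 (by omega) n (by simp) 1 (by omega) rfl
      · exact hfr 0 (by omega) n (by simp) 0 (by omega) rfl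
    · exact ih h

theorem Hist.par {L} (h : Hist m X TL n L) : ∀ g ∈ L, ∃ g' ∈ n :: L, ∃ t ∈ TL, g X = g' t := by
  induction h with
  | nil => simp
  | cons L g hL hinj hpar _ hfr ih =>
    intro g' hg'
    have key : ∃ g'' ∈ n :: L, ∃ t ∈ TL, g' X = g'' t := by
      rcases List.mem_cons.1 hg' with rfl | h
      · exact hpar
      · exact ih _ h
    obtain ⟨a, ha, b⟩ := key
    refine ⟨a, ?_, b⟩
    simp only [List.mem_cons] at ha ⊢; tauto

theorem Hist.root {L} (h : Hist m X TL n L) : ∀ g ∈ L, ∀ g' ∈ L, g X = g' X → g = g' := by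
  induction h with
  | nil => simp
  | cons L g hL hinj hpar hnew hfr ih =>
    intro a ha b hb hab
    rcases List.mem_cons.1 ha with h1 | h1 <;> rcases List.mem_cons.1 hb with h2 | h2
    · exact h1.trans h2.symm
    · subst h1; exact absurd hab.symm (hnew _ h2)
    · subst h2; exact absurd hab (hnew _ h1)
    · exact ih _ h1 _ h2 hab

theorem Hist.ident {L} (hn : Function.Injective n) (h : Hist m X TL n L) :
    ∀ g ∈ n :: L, ∀ g' ∈ n :: L, ∀ i j, i ≤ m → j ≤ m → g i = g' j →
      (g = g' ∧ i = j) ∨ (g ∈ L ∧ i = X) ∨ (g' ∈ L ∧ j = X) := by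
  induction h with
  | nil => simp; exact fun i j _ _ h => hn h
  | cons L g hL hinj hpar hnew hfr ih =>
    intro a ha b hb i j hi hj hab
    by_cases ha' : a = g <;> by_cases hb' : b = g
    · subst ha' hb'; exact Or.inl ⟨rfl, hinj hab⟩
    · subst ha'
      right; left
      refine ⟨by simp, ?_⟩
      by_contra hc
      exact hfr i hc b (by simp only [List.mem_cons] at hb ⊢; tauto) j hj hab
    · subst hb'
      right; right
      refine ⟨by simp, ?_⟩
      by_contra hc
      exact hfr j hc a (by simp only [List.mem_cons] at ha ⊢; tauto) i hi hab.symm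
    · have := ih a (by simp only [List.mem_cons] at ha ⊢; tauto) b
        (by simp only [List.mem_cons] at hb ⊢; tauto) i j hi hj hab
      simp only [List.mem_cons]; tauto

/-- Standing assumptions. -/
structure Ctx (m X : ℕ) (TL : Set ℕ) (n : ℕ → ℕ) : Prop where
  hn : ∀ i, n (n i) = i
  hm : 0 < m
  hX : X ≤ m
  hTL : ∀ t ∈ TL, t ≤ m
  hXT : X ∉ TL

theorem Ctx.inj (K : Ctx m X TL n) : Function.Injective n := by
  intro a b h; rw [← K.hn a, h, K.hn]

theorem Hist.Tne {L} (K : Ctx m X TL n) (h : Hist m X TL n L) :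
    ∀ g ∈ n :: L, ∀ t ∈ TL, g t ≠ n X := by
  intro g hg t ht he
  have hh : t ≠ X := fun h => K.hXT (h ▸ ht)
  rcases h.ident K.inj g hg n (by simp) t X (K.hTL t ht) K.hX he with h1 | h1 | h1
  · exact hh h1.2
  · exact hh h1.2
  · exact h.notmem K.hm h1.1

theorem Hist.Ane {L} (K : Ctx m X TL n) (h : Hist m X TL n L) : ∀ g ∈ L, g X ≠ n X := by
  intro g hg
  obtain ⟨g', hg', t, ht, e⟩ := h.par g hg
  rw [e]; exact h.Tne K g' hg' t ht

/-- a bud at an index different from `X` sits at a `T` index. -/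
theorem Hist.budT {L} (K : Ctx m X TL n) (h : Hist m X TL n L) {g u : ℕ → ℕ} {a : ℕ}
    (hg : g ∈ L) (hu : u ∈ n :: L) (ha : a ≤ m) (haX : a ≠ X) (e : g X = u a) : a ∈ TL := by
  obtain ⟨g', hg', t, ht, e'⟩ := h.par g hg
  have hh : t ≠ X := fun h => K.hXT (h ▸ ht)
  rcases h.ident K.inj g' hg' u hu t a (K.hTL t ht) ha (e'.symm.trans e) with h1 | h1 | h1
  · exact h1.2 ▸ ht
  · exact absurd h1.2 hh
  · exact absurd h1.2 haX

theorem und_iff {L U} (K : Ctx m X TL n) (h : Hist m X TL n L) (hU : U ⊆ TN X TL n L) (a : ℕ) :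
    undecided (cact d m X lab n L U) a ↔ ∃ g ∈ L, a = g X := by
  unfold undecided
  rw [mem_cact_A, mem_cact_F, mem_cact_T]
  constructor
  · exact fun h => h.1
  · rintro ⟨g, hg, rfl⟩
    exact ⟨⟨g, hg, rfl⟩, h.Ane K g hg, fun hh => (hU hh).2 g hg rfl⟩

theorem cert_iff {L U} (K : Ctx m X TL n) (h : Hist m X TL n L) (hU : U ⊆ TN X TL n L) :
    covACert (cact d m X lab n L U) (gq d m X lab TL n) ↔ ∀ c, MM m X lab TL n L U c := by
  unfold covACert
  refine forall_congr' fun c => ?_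
  have hF : ∀ v, (minModel (cact d m X lab n L U) c).FS v ↔ FF X n L c v := by
    intro v; simp only [minModel, FF, mem_cact_F, und_iff K h hU]
  have hT : ∀ v, (minModel (cact d m X lab n L U) c).TS v ↔ TT X L U c v := by
    intro v; simp only [minModel, TT, mem_cact_T, und_iff K h hU]
  constructor
  · rintro ⟨f, hf⟩
    refine ⟨fun i => f (n i), ?_, ?_, ?_⟩
    · exact (hF _).1 (hf (At.F (n X)) (Or.inr (Or.inl rfl)))
    · intro t ht
      exact (hT _).1 (hf (At.T (n t)) (Or.inr (Or.inr ⟨t, ht, rfl⟩)))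
    · intro i hi
      have := hf _ (Or.inl ⟨i, hi, rfl⟩)
      rw [Ed_map, Ed_sat, mem_cact_Ed] at this
      exact this
  · rintro ⟨g, h1, h2, h3⟩
    refine ⟨fun v => g (n v), ?_⟩
    rintro a (⟨i, hi, rfl⟩ | rfl | ⟨t, ht, rfl⟩)
    · rw [Ed_map, Ed_sat, mem_cact_Ed]
      simpa [K.hn] using h3 i hi
    · refine (hF _).2 ?_
      simpa [K.hn] using h1
    · refine (hT _).2 ?_
      simpa [K.hn] using h2 t ht

theorem MM.mono {L U U' c} (hU : U ⊆ U') (h : MM m X lab TL n L U c) : MM m X lab TL n L U' c := by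
  obtain ⟨g, h1, h2, h3⟩ := h
  exact ⟨g, h1, fun t ht => (h2 t ht).imp (fun h => hU h) id, h3⟩

theorem bud_eq (K : Ctx m X TL n) {L U} {g f : ℕ → ℕ} {y x : ℕ} (hf : ∀ i, f (n i) = g i)
    (hx : x = n X) (hy : g X = y) :
    (cact d m X lab n L U \ {At.T y}) ∪ At.map f '' (insert (At.A x) (gq d m X lab TL n \ {At.F x}))
      = cact d m X lab n (g :: L) ((U \ {y}) ∪ g '' TL) := by
  subst hx
  ext a
  constructor
  · rintro (⟨h1, h2⟩ | ⟨b, hb, rfl⟩)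
    · rcases h1 with ⟨g', hg', i, hi, rfl⟩ | rfl | ⟨g', hg', rfl⟩ | ⟨v, hv, rfl⟩
      · exact mem_cact_Ed.2 ⟨g', by simp only [List.mem_cons] at hg' ⊢; tauto, i, hi, rfl, rfl, rfl⟩
      · exact mem_cact_F.2 rfl
      · exact mem_cact_A.2 ⟨g', by simp [hg'], rfl⟩
      · refine mem_cact_T.2 (Or.inl ⟨hv, ?_⟩)
        rintro rfl; exact h2 rfl
    · rcases hb with rfl | ⟨hb, hb2⟩
      · exact mem_cact_A.2 ⟨g, by simp, hf X⟩
      · rcases hb with ⟨i, hi, rfl⟩ | rfl | ⟨t, ht, rfl⟩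
        · rw [Ed_map, hf, hf]
          exact mem_cact_Ed.2 ⟨g, by simp, i, hi, rfl, rfl, rfl⟩
        · exact absurd rfl hb2
        · refine mem_cact_T.2 (Or.inr ⟨t, ht, (hf t).symm⟩)
  · rintro (⟨g', hg', i, hi, rfl⟩ | rfl | ⟨g', hg', rfl⟩ | ⟨v, hv, rfl⟩)
    · by_cases hgg : g' = g
      · subst hgg
        right
        refine ⟨Ed d (lab i) (n i) (n (i+1)), Or.inr ⟨Or.inl ⟨i, hi, rfl⟩, Ed_ne_F _ _ _ _ _⟩, ?_⟩
        rw [Ed_map, hf, hf]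
      · left
        exact ⟨mem_cact_Ed.2 ⟨g', by simp only [List.mem_cons] at hg' ⊢; tauto, i, hi, rfl, rfl, rfl⟩,
          Ed_ne_T _ _ _ _ _⟩
    · left; exact ⟨mem_cact_F.2 rfl, by simp⟩
    · rcases List.mem_cons.1 hg' with rfl | hg'
      · right
        exact ⟨At.A (n X), Or.inl rfl, by simp [At.map, hf]⟩
      · left; exact ⟨mem_cact_A.2 ⟨g', hg', rfl⟩, by simp⟩
    · rcases hv with ⟨hv, hvy⟩ | ⟨t, ht, rfl⟩
      · left; exact ⟨mem_cact_T.2 hv, by simpa using hvy⟩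
      · right
        exact ⟨At.T (n t), Or.inr ⟨Or.inr (Or.inr ⟨t, ht, rfl⟩), by simp⟩, by simp [At.map, hf]⟩

theorem cact_nil : cact d m X lab n [] (n '' TL) = gq d m X lab TL n := by
  ext a
  simp only [cact, gq, Set.mem_ofPred_eq, List.mem_singleton, List.not_mem_nil, false_and,
    exists_false, false_or, exists_eq_left, Set.mem_image, exists_exists_and_eq_and]

theorem TN_nil : TN X TL n [] = n '' TL := by
  ext v; simp [TN, eq_comm]

theorem TN_cons (K : Ctx m X TL n) {L} {g : ℕ → ℕ} (h : Hist m X TL n (g :: L)) :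
    (TN X TL n L \ {g X}) ∪ g '' TL = TN X TL n (g :: L) := by
  cases h with
  | cons _ _ hL hinj hpar hnew hfr =>
  ext v
  constructor
  · rintro (⟨⟨⟨g', hg', t, ht, rfl⟩, h2⟩, h3⟩ | ⟨t, ht, rfl⟩)
    · refine ⟨⟨g', by simp only [List.mem_cons] at hg' ⊢; tauto, t, ht, rfl⟩, ?_⟩
      intro b hb
      rcases List.mem_cons.1 hb with rfl | hb
      · exact fun h => h3 h.symm
      · exact h2 b hb
    · have hh : t ≠ X := fun h => K.hXT (h ▸ ht)
      refine ⟨⟨g, by simp, t, ht, rfl⟩, ?_⟩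
      intro b hb
      rcases List.mem_cons.1 hb with rfl | hb
      · exact fun h => hh (hinj h).symm
      · exact fun h => hfr t hh b (by simp [hb]) X K.hX h.symm
  · rintro ⟨⟨g', hg', t, ht, rfl⟩, h2⟩
    by_cases hgg : g' = g
    · subst hgg; exact Or.inr ⟨t, ht, rfl⟩
    · left
      refine ⟨⟨⟨g', by simp only [List.mem_cons] at hg' ⊢; tauto, t, ht, rfl⟩, fun b hb => h2 b (by simp [hb])⟩, ?_⟩
      exact fun h => h2 g (by simp) h.symm

theorem occ_cact (K : Ctx m X TL n) {L U} {g : ℕ → ℕ} (hg : g ∈ n :: L) {i : ℕ} (hi : i ≤ m) :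
    occ (cact d m X lab n L U) (g i) := by
  rcases Nat.lt_or_ge i m with h | h
  · exact ⟨_, mem_cact_Ed.2 ⟨g, hg, i, h, rfl, rfl, rfl⟩, (Ed_vars _ _ _ _).1⟩
  · obtain ⟨j, rfl⟩ : ∃ j, i = j + 1 := ⟨i - 1, by have := K.hm; omega⟩
    exact ⟨_, mem_cact_Ed.2 ⟨g, hg, j, by omega, rfl, rfl, rfl⟩, (Ed_vars _ _ _ _).2⟩

theorem occ_cact_inv (K : Ctx m X TL n) {L U v} (h : Hist m X TL n L) (hU : U ⊆ TN X TL n L)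
    (ho : occ (cact d m X lab n L U) v) : ∃ g ∈ n :: L, ∃ i, i ≤ m ∧ v = g i := by
  obtain ⟨a, ha, hv⟩ := ho
  rcases ha with ⟨g', hg', i, hi, rfl⟩ | rfl | ⟨g', hg', rfl⟩ | ⟨w, hw, rfl⟩
  · have : v = g' i ∨ v = g' (i+1) := by
      cases d <;> simp [Ed, At.vars] at hv <;> tauto
    rcases this with h | h
    · exact ⟨g', hg', i, by omega, h⟩
    · exact ⟨g', hg', i+1, by omega, h⟩
  · exact ⟨n, by simp, X, K.hX, by simpa [At.vars] using hv⟩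
  · exact ⟨g', by simp [hg'], X, K.hX, by simpa [At.vars] using hv⟩
  · obtain ⟨⟨g', hg', t, ht, rfl⟩, _⟩ := hU hw
    exact ⟨g', hg', t, K.hTL t ht, by simpa [At.vars] using hv⟩

theorem cact_diff {L U y} :
    cact d m X lab n L U \ {At.T y} = cact d m X lab n L (U \ {y}) := by
  ext a
  constructor
  · rintro ⟨h | h | h | ⟨v, hv, rfl⟩, h2⟩
    · exact Or.inl h
    · exact Or.inr (Or.inl h)
    · exact Or.inr (Or.inr (Or.inl h))
    · exact mem_cact_T.2 ⟨hv, fun h => h2 (by rw [h]; rfl)⟩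
  · rintro (⟨g, hg, i, hi, rfl⟩ | rfl | ⟨g, hg, rfl⟩ | ⟨v, hv, rfl⟩)
    · exact ⟨mem_cact_Ed.2 ⟨g, hg, i, hi, rfl, rfl, rfl⟩, Ed_ne_T _ _ _ _ _⟩
    · exact ⟨mem_cact_F.2 rfl, by simp⟩
    · exact ⟨mem_cact_A.2 ⟨g, hg, rfl⟩, by simp⟩
    · exact ⟨mem_cact_T.2 hv.1, by simpa using hv.2⟩

theorem cac_to (K : Ctx m X TL n) {C S seg tc}
    (hC : CacP (gq d m X lab TL n) (n X) C S seg tc) :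
    ∃ L U, Hist m X TL n L ∧ U ⊆ TN X TL n L ∧ C = cact d m X lab n L U ∧
      (∀ c, MM m X lab TL n L U c) ∧ (∀ i, i ≤ m → seg (n i) = []) ∧
      (∀ g ∈ L, ∀ i, i ≤ m → i ≠ X → seg (g i) = seg (g X) ++ [g X]) ∧
      (∀ s ∈ S, s = [] ∨ ∃ g ∈ L, s = seg (g X) ++ [g X]) := by
  induction hC with
  | base =>
    refine ⟨[], n '' TL, Hist.nil, TN_nil.ge, cact_nil.symm, ?_, by simp, by simp, by simp⟩
    intro c
    refine ⟨n, Or.inl rfl, fun t ht => Or.inl ⟨t, ht, rfl⟩, ?_⟩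
    intro i hi
    exact ⟨n, by simp, i, hi, rfl, rfl, rfl⟩
  | bud C S seg tc hC y hyT hyF f hinj hfx hfresh ih =>
    obtain ⟨L, U, hH, hU, rfl, hM, hs0, hsL, hS⟩ := ih
    have hyU : y ∈ U := mem_cact_T.1 hyT
    have hyTN := hU hyU
    have hfr : ∀ v, v ≠ X → ∀ g' ∈ n :: L, ∀ i, i ≤ m → (f ∘ n) v ≠ g' i := by
      intro v hv g' hg' i hi he
      refine hfresh (n v) (fun h => hv (K.inj h)) ?_
      have := occ_cact (d := d) (lab := lab) (U := U) K hg' hi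
      rw [← he] at this; exact this
    have hH' : Hist m X TL n ((f ∘ n) :: L) := by
      refine Hist.cons L (f ∘ n) hH (hinj.comp K.inj) ?_ ?_ hfr
      · obtain ⟨g', hg', t, ht, e⟩ := hyTN.1
        exact ⟨g', hg', t, ht, by simp [hfx, e]⟩
      · intro g' hg'
        simpa [hfx] using hyTN.2 g' hg'
    have hold : ∀ g ∈ n :: L, ∀ i, i ≤ m →
        (if g i ∈ Set.range f ∧ g i ≠ y then seg y ++ [y] else seg (g i)) = seg (g i) := by
      intro g hg i hi
      rw [if_neg]
      rintro ⟨⟨w, hw⟩, h2⟩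
      refine hfr (n w) ?_ g hg i hi (by simp [K.hn, hw])
      intro h
      apply h2
      rw [← hw, ← hfx, ← h, K.hn]
    have hfX : (f ∘ n) X = y := hfx
    refine ⟨(f ∘ n) :: L, (U \ {y}) ∪ (f ∘ n) '' TL, hH', ?_, ?_, ?_, ?_, ?_, ?_⟩
    · rw [← TN_cons K hH', hfX]
      exact Set.union_subset_union_left _ (Set.sdiff_subset_sdiff_left hU)
    · exact bud_eq K (fun i => rfl) rfl hfx
    · intro c
      have hedge : ∀ s a b, edge m lab n L s a b → edge m lab n ((f ∘ n) :: L) s a b := by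
        rintro s a b ⟨g, hg, h⟩
        exact ⟨g, by simp only [List.mem_cons] at hg ⊢; tauto, h⟩
      cases hc : c y
      · obtain ⟨g, h1, h2, h3⟩ := hM c
        refine ⟨g, ?_, ?_, fun i hi => hedge _ _ _ (h3 i hi)⟩
        · rcases h1 with h1 | ⟨⟨g', hg', e⟩, h1⟩
          · exact Or.inl h1
          · exact Or.inr ⟨⟨g', by simp [hg'], e⟩, h1⟩
        · intro t ht
          rcases h2 t ht with h2 | ⟨⟨g', hg', e⟩, h2⟩
          · by_cases hty : g t = y
            · exact Or.inr ⟨⟨f ∘ n, by simp, hty.trans hfX.symm⟩, by rw [hty, hc]⟩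
            · exact Or.inl (Or.inl ⟨h2, hty⟩)
          · exact Or.inr ⟨⟨g', by simp [hg'], e⟩, h2⟩
      · refine ⟨f ∘ n, Or.inr ⟨⟨f ∘ n, by simp, rfl⟩, by rw [hfX, hc]⟩, ?_, ?_⟩
        · intro t ht; exact Or.inl (Or.inr ⟨t, ht, rfl⟩)
        · intro i hi; exact ⟨f ∘ n, by simp, i, hi, rfl, rfl, rfl⟩
    · intro i hi
      exact (hold n (by simp) i hi).trans (hs0 i hi)
    · intro g hg i hi hiX
      have hyy : (if y ∈ Set.range f ∧ y ≠ y then seg y ++ [y] else seg y) = seg y := by simp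
      rcases List.mem_cons.1 hg with rfl | hg
      · dsimp only
        rw [hfX, hyy, if_pos]
        refine ⟨⟨n i, rfl⟩, ?_⟩
        intro h
        exact hiX ((hinj.comp K.inj) (h.trans hfX.symm))
      · have e1 := hold g (by simp [hg]) i hi
        have e2 := hold g (by simp [hg]) X K.hX
        dsimp only
        rw [e1, e2]; exact hsL g hg i hi hiX
    · intro s hs
      have hyy : (if y ∈ Set.range f ∧ y ≠ y then seg y ++ [y] else seg y) = seg y := by simp
      rcases hs with rfl | hs
      · right
        refine ⟨f ∘ n, by simp, ?_⟩
        dsimp only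
        rw [hfX, hyy]
      · rcases hS s hs with h | ⟨g, hg, h⟩
        · exact Or.inl h
        · right
          refine ⟨g, by simp [hg], ?_⟩
          have e2 := hold g (by simp [hg]) X K.hX
          dsimp only
          rw [e2]; exact h
  | prune C S seg tc hC y hyT hyF hent ih =>
    obtain ⟨L, U, hH, hU, rfl, hM, hs0, hsL, hS⟩ := ih
    have hU' : U \ {y} ⊆ TN X TL n L := Set.sdiff_subset.trans hU
    rw [cact_diff] at hent ⊢
    exact ⟨L, U \ {y}, hH, hU', rfl, (cert_iff K hH hU').1 hent, hs0, hsL, hS⟩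

theorem to_cac (K : Ctx m X TL n) {L} (h : Hist m X TL n L) :
    ∃ S seg tc, CacP (gq d m X lab TL n) (n X) (cact d m X lab n L (TN X TL n L)) S seg tc := by
  induction h with
  | nil => rw [TN_nil, cact_nil]; exact ⟨_, _, _, CacP.base⟩
  | cons L g hL hinj hpar hnew hfr ih =>
    obtain ⟨S, seg, tc, ih⟩ := ih
    have hH : Hist m X TL n (g :: L) := Hist.cons L g hL hinj hpar hnew hfr
    have hyTN : g X ∈ TN X TL n L := ⟨hpar, hnew⟩
    have := CacP.bud _ S seg tc ih (g X) (mem_cact_T.2 hyTN)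
      (fun h => hH.Ane K g (by simp) (mem_cact_F.1 h)) (g ∘ n) (hinj.comp K.inj)
      (by simp [K.hn]) (by
        intro v hv ho
        obtain ⟨g', hg', i, hi, e⟩ := occ_cact_inv K hL (le_refl _) ho
        refine hfr (n v) ?_ g' hg' i hi e
        rintro rfl; exact hv (K.hn v).symm)
    rw [bud_eq K (f := g ∘ n) (g := g) (fun i => by simp [K.hn]) rfl rfl, TN_cons K hH] at this
    exact ⟨_, _, _, this⟩

theorem TN_fin (K : Ctx m X TL n) (L : List (ℕ → ℕ)) : (TN X TL n L).Finite := by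
  have hT : TL.Finite := (Set.finite_Iic m).subset K.hTL
  have : (⋃ g ∈ {g | g ∈ n :: L}, g '' TL).Finite :=
    Set.Finite.biUnion (List.finite_toSet _) (fun g _ => hT.image g)
  refine this.subset ?_
  rintro v ⟨⟨g, hg, t, ht, rfl⟩, _⟩
  exact Set.mem_biUnion hg ⟨t, ht, rfl⟩

theorem to_cac' (K : Ctx m X TL n) {L U} (h : Hist m X TL n L) (hU : U ⊆ TN X TL n L)
    (hM : ∀ c, MM m X lab TL n L U c) :
    ∃ S seg tc, CacP (gq d m X lab TL n) (n X) (cact d m X lab n L U) S seg tc := by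
  have key : ∀ D : Set ℕ, D.Finite → D ⊆ TN X TL n L \ U →
      ∃ S seg tc, CacP (gq d m X lab TL n) (n X) (cact d m X lab n L (TN X TL n L \ D)) S seg tc := by
    intro D hD
    induction D, hD using Set.Finite.induction_on with
    | empty => intro _; simpa using to_cac K h
    | @insert y D hy hD ih =>
      intro hs
      obtain ⟨S, seg, tc, ih⟩ := ih ((Set.subset_insert _ _).trans hs)
      have hyy := hs (Set.mem_insert y D)
      have e : TN X TL n L \ insert y D = (TN X TL n L \ D) \ {y} := by
        ext v; simp only [Set.mem_sdiff, Set.mem_insert_iff, Set.mem_singleton_iff]; tauto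
      refine ⟨S, seg, tc, ?_⟩
      rw [e, ← cact_diff]
      refine CacP.prune _ S seg tc ih y (mem_cact_T.2 ⟨hyy.1, hy⟩) ?_ ?_
      · intro hF
        obtain ⟨⟨g, hg, t, ht, e⟩, _⟩ := hyy.1
        exact h.Tne K g hg t ht (e.symm.trans (mem_cact_F.1 hF))
      · rw [cact_diff, ← e, cert_iff K h Set.sdiff_subset]
        intro c
        refine (hM c).mono ?_
        intro v hv
        exact ⟨hU hv, fun h => (hs h).2 hv⟩
  have := key (TN X TL n L \ U) ((TN_fin K L).subset Set.sdiff_subset) le_rfl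
  rwa [Set.sdiff_sdiff_cancel_left hU] at this

/-- Copies reachable from the root along a hole-free path of the cactus. -/
inductive Live (X p r : ℕ) (n : ℕ → ℕ) (L : List (ℕ → ℕ)) (U : Set ℕ) : (ℕ → ℕ) → Prop
  | root : Live X p r n L U n
  | step (g' g : ℕ → ℕ) (i : ℕ) (h : Live X p r n L U g') (hg : g ∈ L) (hi : 1 ≤ i) (hir : i ≤ r)
      (e : g X = g' (X + i * p))
      (hh : ∀ j, 1 ≤ j → j ≤ i → g' (X + j * p) ∈ U ∨ ∃ g'' ∈ L, g'' X = g' (X + j * p)) :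
      Live X p r n L U g

theorem Live.mem {p r L U g} (h : Live X p r n L U g) : g ∈ n :: L := by
  cases h with
  | root => simp
  | step g' _ i h hg => simp [hg]

/-- Periodicity data. -/
structure Per (m X p r : ℕ) (lab : ℕ → σ) (TL : Set ℕ) : Prop where
  hp : 0 < p
  hr : 1 ≤ r
  hT : ∀ x, x ∈ TL ↔ ∃ k, 1 ≤ k ∧ k ≤ r ∧ x = X + k * p
  hlab : ∀ i, X ≤ i → i + p < m → lab (i + p) = lab i

theorem Per.iter {p r} (P : Per m X p r lab TL) (k i : ℕ) (h : X ≤ k) (h2 : k + i * p < m) :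
    lab (k + i * p) = lab k := by
  induction i with
  | zero => simp
  | succ i ih =>
    have e : k + (i + 1) * p = (k + i * p) + p := by ring
    rw [e] at h2 ⊢
    rw [P.hlab _ (by omega) h2, ih (by omega)]

theorem Per.le {p r} (K : Ctx m X TL n) (P : Per m X p r lab TL) : X + r * p ≤ m :=
  K.hTL _ ((P.hT _).2 ⟨r, P.hr, le_rfl, rfl⟩)

theorem Per.le' {p r} (K : Ctx m X TL n) (P : Per m X p r lab TL) {i} (hi : i ≤ r) :
    X + i * p ≤ m := by
  have := P.le K
  have := Nat.mul_le_mul_right p hi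
  omega

/-- Forward part of a match. -/
def Good (m X p r : ℕ) (lab : ℕ → σ) (n : ℕ → ℕ) (L : List (ℕ → ℕ)) (U : Set ℕ) (c : ℕ → Bool)
    (v : ℕ) : Prop :=
  ∃ w : ℕ → ℕ, w 0 = v ∧ (∀ k, X + k < m → edge m lab n L (lab (X + k)) (w k) (w (k + 1))) ∧
    ∀ k, 1 ≤ k → k ≤ r → TT X L U c (w (k * p))

theorem Good.fin {p r L U c} (P : Per m X p r lab TL) {g : ℕ → ℕ} (hg : g ∈ n :: L)
    (hF : FF X n L c (g X)) (h : Good m X p r lab n L U c (g X)) : MM m X lab TL n L U c := by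
  obtain ⟨w, h0, h1, h2⟩ := h
  refine ⟨fun i => if i ≤ X then g i else w (i - X), by simpa using hF, ?_, ?_⟩
  · intro t ht
    obtain ⟨k, hk1, hkr, rfl⟩ := (P.hT t).1 ht
    have : 0 < k * p := Nat.mul_pos hk1 P.hp
    dsimp only
    rw [if_neg (by omega), Nat.add_sub_cancel_left]
    exact h2 k hk1 hkr
  · intro i hi
    dsimp only
    rcases lt_trichotomy i X with h | h | h
    · rw [if_pos (by omega), if_pos (by omega)]
      exact ⟨g, hg, i, hi, rfl, rfl, rfl⟩
    · subst h
      rw [if_pos (by omega), if_neg (by omega), ← h0]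
      have := h1 0 (by omega)
      simpa using this
    · rw [if_neg (by omega), if_neg (by omega)]
      have := h1 (i - X) (by omega)
      rw [show X + (i - X) = i by omega, show i - X + 1 = i + 1 - X by omega] at this
      exact this

theorem Good.back {p r L U c} (K : Ctx m X TL n) (P : Per m X p r lab TL) {g : ℕ → ℕ}
    (hg : g ∈ n :: L) {i : ℕ}
    (hi : i + 1 ≤ r) (hT : TT X L U c (g (X + (i + 1) * p)))
    (h : Good m X p r lab n L U c (g (X + (i + 1) * p))) :
    Good m X p r lab n L U c (g (X + i * p)) := by
  obtain ⟨w, h0, h1, h2⟩ := h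
  have hle := P.le' K hi
  have hp := P.hp
  have ee : (i + 1) * p = i * p + p := by ring
  refine ⟨fun k => if k ≤ p then g (X + i * p + k) else w (k - p), by simp, ?_, ?_⟩
  · intro k hk
    dsimp only
    rcases lt_trichotomy k p with h | h | h
    · rw [if_pos (by omega), if_pos (by omega)]
      refine ⟨g, hg, X + i * p + k, by omega, ?_, rfl, rfl⟩
      rw [show X + i * p + k = (X + k) + i * p by ring]
      exact (P.iter _ _ (by omega) (by omega)).symm
    · subst h
      rw [if_pos (by omega), if_neg (by omega)]
      have := h1 0 (by omega)
      rw [h0, ee] at this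
      rw [P.hlab X le_rfl hk, show k + 1 - k = 0 + 1 by omega,
        show X + i * k + k = X + (i * k + k) by ring]
      exact this
    · rw [if_neg (by omega), if_neg (by omega)]
      have := h1 (k - p) (by omega)
      rw [← P.hlab _ (by omega) (by omega), show X + (k - p) + p = X + k by omega,
        show k - p + 1 = k + 1 - p by omega] at this
      exact this
  · intro k hk1 hkr
    dsimp only
    rcases Nat.lt_or_ge 1 k with h | h
    · obtain ⟨j, rfl⟩ : ∃ j, k = j + 1 := ⟨k - 1, by omega⟩
      have e2 : (j + 1) * p = j * p + p := by ring
      have : 0 < j * p := Nat.mul_pos (by omega) hp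
      rw [if_neg (by omega), e2, Nat.add_sub_cancel]
      exact h2 j (by omega) (by omega)
    · obtain rfl : k = 1 := by omega
      rw [if_pos (by omega), one_mul, show X + i * p + p = X + (i * p + p) by ring, ← ee]
      exact hT

theorem Live.match {p r L U c} (K : Ctx m X TL n) (P : Per m X p r lab TL) {u : ℕ → ℕ}
    (hu : Live X p r n L U u) (h : Good m X p r lab n L U c (u X)) : MM m X lab TL n L U c := by
  induction hu with
  | root => exact h.fin P (by simp) (Or.inl rfl)
  | step g' g i hl hg hi hir e hh ih =>
    have key : ∀ j, j ≤ i → Good m X p r lab n L U c (g' (X + (i - j) * p)) ∨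
        MM m X lab TL n L U c := by
      intro j
      induction j with
      | zero => intro _; left; rw [Nat.sub_zero, ← e]; exact h
      | succ j ihj =>
        intro hj
        rcases ihj (by omega) with hG | hG
        · have e3 : i - j = (i - (j + 1)) + 1 := by omega
          rw [e3] at hG
          have hn := hh (i - (j+1) + 1) (by omega) (by omega)
          rcases hn with hn | ⟨g'', hg'', hn⟩
          · exact Or.inl (hG.back K P hl.mem (by omega) (Or.inl hn))
          · cases hc : c (g'' X)
            · exact Or.inl (hG.back K P hl.mem (by omega)
                (Or.inr ⟨⟨g'', hg'', hn.symm⟩, by rw [← hn, hc]⟩))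
            · right
              rw [← hn] at hG
              exact hG.fin P (by simp [hg'']) (Or.inr ⟨⟨g'', hg'', rfl⟩, hc⟩)
        · exact Or.inr hG
    rcases key i le_rfl with h | h
    · apply ih; simpa using h
    · exact h

theorem suff {p r L U} (K : Ctx m X TL n) (P : Per m X p r lab TL) {u : ℕ → ℕ}
    (hu : Live X p r n L U u) (h : ∀ t ∈ TL, u t ∈ U) (c : ℕ → Bool) :
    MM m X lab TL n L U c := by
  refine hu.match K P ⟨fun k => u (X + k), rfl, ?_, ?_⟩
  · intro k hk; exact ⟨u, hu.mem, X + k, hk, rfl, rfl, rfl⟩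
  · intro k h1 h2
    exact Or.inl (h _ ((P.hT _).2 ⟨k, h1, h2, rfl⟩))

theorem nec_key {p r L U c} (K : Ctx m X TL n) (P : Per m X p r lab TL) (H : Hist m X TL n L)
    (hU : U ⊆ TN X TL n L) (hc : ∀ g, Live X p r n L U g → c (g X) = true)
    {f : ℕ → ℕ} (hT : ∀ t ∈ TL, TT X L U c (f t))
    (hE : ∀ i, i < m → edge m lab n L (lab i) (f i) (f (i + 1)))
    {u : ℕ → ℕ} (hu : Live X p r n L U u) {i : ℕ}
    (hh : ∀ j, 1 ≤ j → j ≤ i → u (X + j * p) ∈ U ∨ ∃ g'' ∈ L, g'' X = u (X + j * p))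
    (h0 : f X = u (X + i * p)) (h1 : f (X + 1) = u (X + i * p + 1)) (hle : X + i * p + 1 ≤ m) :
    ∀ t ∈ TL, u t ∈ U := by
  have hp := P.hp
  have key : ∀ k, X + k ≤ m → X + i * p + k ≤ m ∧ f (X + k) = u (X + i * p + k) ∧
      ∀ j, 1 ≤ j → j * p ≤ k → i + j ≤ r → u (X + (i + j) * p) ∈ U := by
    intro k
    induction k with
    | zero =>
      intro _
      refine ⟨by omega, h0, ?_⟩
      intro j hj hjp
      have : 0 < j * p := Nat.mul_pos hj hp
      omega
    | succ k ih =>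
      intro hk
      obtain ⟨a1, a2, a3⟩ := ih (by omega)
      have step : X + i * p + (k + 1) ≤ m ∧ f (X + (k + 1)) = u (X + i * p + (k + 1)) := by
        rcases Nat.eq_zero_or_pos k with rfl | hkpos
        · exact ⟨by omega, by simpa using h1⟩
        · obtain ⟨g, hg, j, hj, _, e1, e2⟩ := hE (X + k) (by omega)
          rw [a2] at e1
          rcases H.ident K.inj g hg u hu.mem j (X + i * p + k) (by omega) a1 e1.symm with
            ⟨rfl, rfl⟩ | ⟨hgL, rfl⟩ | ⟨_, hx⟩
          · exact ⟨by omega, e2⟩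
          · exfalso
            have hTL := H.budT K hgL hu.mem a1 (by omega) e1.symm
            obtain ⟨q, hq1, hqr, hq⟩ := (P.hT _).1 hTL
            have hiq : i < q := by
              by_contra hcon
              have := Nat.mul_le_mul_right p (Nat.le_of_not_lt hcon)
              omega
            obtain ⟨j, rfl⟩ : ∃ j, q = i + j := ⟨q - i, by omega⟩
            have ej : (i + j) * p = i * p + j * p := by ring
            have := a3 j (by omega) (by omega) hqr
            refine (hU this).2 g hgL ?_
            rw [← e1, hq]
          · omega
      refine ⟨step.1, step.2, ?_⟩
      intro j hj hjp hjr
      rcases Nat.lt_or_ge k (j * p) with hlt | hge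
      · have ek : j * p = k + 1 := by omega
        have hx := hT (X + j * p) ((P.hT _).2 ⟨j, hj, by omega, rfl⟩)
        have ej : (i + j) * p = i * p + j * p := by ring
        rw [ek, step.2, show X + i * p + (k + 1) = X + (i + j) * p by omega] at hx
        rcases hx with hx | ⟨⟨g, hg, e⟩, hx⟩
        · exact hx
        · exfalso
          have : Live X p r n L U g := by
            refine Live.step u g (i + j) hu hg (by omega) hjr e.symm ?_
            intro j' h1' h2'
            rcases Nat.lt_or_ge i j' with h3 | h3
            · rcases Nat.lt_or_ge j' (i + j) with h4 | h4
              · left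
                obtain ⟨s, rfl⟩ : ∃ s, j' = i + s := ⟨j' - i, by omega⟩
                refine a3 s (by omega) ?_ (by omega)
                have h5 : (s + 1) * p ≤ j * p := Nat.mul_le_mul_right p (by omega)
                have h6 : (s + 1) * p = s * p + p := by ring
                omega
              · obtain rfl : j' = i + j := by omega
                exact Or.inr ⟨g, hg, e.symm⟩
            · exact hh j' h1' h3
          have := hc g this
          rw [e, this] at hx
          exact absurd hx (by simp)
      · exact a3 j hj hge hjr
  have hX := K.hX
  obtain ⟨b1, _, b3⟩ := key (m - X) (by omega)
  have hip : i * p = 0 := by omega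
  have hi0 : i = 0 := by
    rcases Nat.mul_eq_zero.1 hip with h | h
    · exact h
    · omega
  subst hi0
  intro t ht
  obtain ⟨k, hk1, hkr, rfl⟩ := (P.hT t).1 ht
  have := b3 k hk1 (by have := P.le' K hkr; omega) (by omega)
  simpa using this

theorem nec {p r L U} (K : Ctx m X TL n) (P : Per m X p r lab TL) (H : Hist m X TL n L)
    (hU : U ⊆ TN X TL n L) (hM : ∀ c, MM m X lab TL n L U c) :
    ∃ u, Live X p r n L U u ∧ ∀ t ∈ TL, u t ∈ U := by
  have hp := P.hp
  have hXm : X < m := by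
    have := P.le' K P.hr
    omega
  let c : ℕ → Bool := fun z => decide (∃ g, Live X p r n L U g ∧ z = g X)
  have hc : ∀ g, Live X p r n L U g → c (g X) = true := by
    intro g hg; simp only [c, decide_eq_true_eq]; exact ⟨g, hg, rfl⟩
  obtain ⟨f, hF, hT, hE⟩ := hM c
  have hu : ∃ u, Live X p r n L U u ∧ f X = u X := by
    rcases hF with h | ⟨_, h⟩
    · exact ⟨n, Live.root, h⟩
    · simpa only [c, decide_eq_true_eq] using h
  obtain ⟨u, hu, hfu⟩ := hu
  obtain ⟨g, hg, j, hj, _, e1, e2⟩ := hE X hXm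
  have own : f (X + 1) = u (X + 1) → ∃ u, Live X p r n L U u ∧ ∀ t ∈ TL, u t ∈ U := by
    intro h
    refine ⟨u, hu, nec_key K P H hU hc hT hE hu (i := 0) ?_ (by simpa using hfu)
      (by simpa using h) (by omega)⟩
    intro j h1 h2; omega
  have gX : g ∈ L → j = X → ∃ u, Live X p r n L U u ∧ ∀ t ∈ TL, u t ∈ U := by
    intro hgL hjX
    subst hjX
    apply own
    rw [e2]
    rcases List.mem_cons.1 hu.mem with hun | huL
    · exfalso
      apply H.Ane K g hgL
      rw [← e1, hfu, hun]
    · rw [H.root g hgL u huL (e1.symm.trans hfu)]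
  rcases H.ident K.inj g hg u hu.mem j X (by omega) K.hX (e1.symm.trans hfu) with
    ⟨rfl, rfl⟩ | ⟨hgL, hjX⟩ | ⟨huL, _⟩
  · exact own e2
  · exact gX hgL hjX
  · cases hu with
    | root => exact absurd huL (H.notmem K.hm)
    | step g' _ i hl hg' hi hir e hh =>
      have hip : 0 < i * p := Nat.mul_pos hi hp
      rcases H.ident K.inj g hg g' hl.mem j (X + i * p) (by omega) (P.le' K hir)
        (e1.symm.trans (hfu.trans e)) with ⟨rfl, rfl⟩ | ⟨hgL, hjX⟩ | ⟨_, hx⟩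
      · exact ⟨g, hl, nec_key K P H hU hc hT hE hl hh (hfu.trans e) e2 (by omega)⟩
      · exact gX hgL hjX
      · omega

theorem Hist.filter {L} (H : Hist m X TL n L) (Q : (ℕ → ℕ) → Prop)
    (hQ : ∀ g ∈ L, Q g → ∀ g' ∈ n :: L, ∀ t ∈ TL, g X = g' t → g' = n ∨ Q g') :
    Hist m X TL n (L.filter (fun g => decide (Q g))) := by
  induction H with
  | nil => exact Hist.nil
  | cons L g hL hinj hpar hnew hfr ih =>
    have ih' := ih (by
      intro a ha h1 b hb
      exact hQ a (by simp [ha]) h1 b (by simp only [List.mem_cons] at hb ⊢; tauto))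
    by_cases hg : Q g
    · rw [List.filter_cons_of_pos (by simpa using hg)]
      refine Hist.cons _ g ih' hinj ?_ ?_ ?_
      · obtain ⟨g', hg', t, ht, e⟩ := hpar
        refine ⟨g', ?_, t, ht, e⟩
        have h2 := hQ g (by simp) hg g' (by simp only [List.mem_cons] at hg' ⊢; tauto) t ht e
        simp only [List.mem_cons, List.mem_filter, decide_eq_true_eq] at hg' ⊢
        tauto
      · intro g' hg'
        exact hnew g' (List.mem_filter.1 hg').1
      · intro v hv g' hg'
        refine hfr v hv g' ?_
        simp only [List.mem_cons, List.mem_filter] at hg' ⊢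
        tauto
    · rw [List.filter_cons_of_neg (by simpa using hg)]
      exact ih'

theorem br_of {S : Set (List ℕ)} (s : List ℕ)
    (h : ∀ w ∈ S, ∀ l, l <+: w → l ≠ w → l <+: s) : brLE S 1 := by
  rintro ⟨e, h1, h2, h3⟩
  have ht := h2 [true] true (by simp)
  have hf := h2 [false] true (by simp)
  have a := h _ (h1 ([true] ++ [true]) (by simp)) _ ht.1 ht.2
  have b := h _ (h1 ([false] ++ [true]) (by simp)) _ hf.1 hf.2
  have := h3 [] (by simp)
  rcases List.prefix_or_prefix_of_prefix a b with h | h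
  · exact this.1 h
  · exact this.2 h

theorem chain_one {L} {t : ℕ} (H : Hist m X {t} n L) (AD : (ℕ → ℕ) → List ℕ)
    (hAD : ∀ g ∈ L, ∀ g' ∈ n :: L, g X = g' t → AD g = AD g' ++ [g X]) :
    ∃ hd ∈ n :: L, (∀ g ∈ n :: L, AD g <+: AD hd) ∧
      ∀ g ∈ n :: L, g = hd ∨ ∃ g2 ∈ L, g2 X = g t := by
  induction H with
  | nil => exact ⟨n, by simp, by simp, by simp⟩
  | cons L g hL hinj hpar hnew hfr ih =>
    obtain ⟨hd, hhd, i1, i2⟩ := ih (by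
      intro a ha b hb
      exact hAD a (by simp [ha]) b (by simp only [List.mem_cons] at hb ⊢; tauto))
    obtain ⟨g', hg', t', rfl, e⟩ := hpar
    have hgh : g' = hd := by
      rcases i2 g' hg' with h | ⟨g2, hg2, h⟩
      · exact h
      · exact absurd (h.trans e.symm) (hnew g2 hg2)
    subst hgh
    have eA := hAD g (by simp) g' (by simp only [List.mem_cons] at hg' ⊢; tauto) e
    refine ⟨g, by simp, ?_, ?_⟩
    · intro a ha
      by_cases hag : a = g
      · subst hag; exact List.prefix_rfl
      · rw [eA]
        exact (i1 a (by simp only [List.mem_cons] at ha ⊢; tauto)).trans (List.prefix_append _ _)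
    · intro a ha
      by_cases hag : a = g
      · exact Or.inl hag
      · right
        rcases i2 a (by simp only [List.mem_cons] at ha ⊢; tauto) with rfl | ⟨g2, hg2, h⟩
        · exact ⟨g, by simp, e⟩
        · exact ⟨g2, by simp [hg2], h⟩

theorem core (K : Ctx m X TL n) (hper : (∃ t, TL = {t}) ∨ ∃ p r, Per m X p r lab TL)
    {C S seg tc} (hC : CacP (gq d m X lab TL n) (n X) C S seg tc)
    (hmin : ∀ (C' : Set (At σ ℕ)) S' seg' tc',
      CacP (gq d m X lab TL n) (n X) C' S' seg' tc' →
      ∀ g : ℕ → ℕ, Function.Injective g → At.map g '' C' ⊆ C → At.map g '' C' = C) :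
    brLE S 1 := by
  obtain ⟨L, U, H, hU, rfl, hM, hs0, hsL, hS⟩ := cac_to K hC
  let AD : (ℕ → ℕ) → List ℕ := fun g => if g = n then [] else seg (g X) ++ [g X]
  have hADL : ∀ g ∈ L, AD g = seg (g X) ++ [g X] := by
    intro g hg
    simp only [AD]
    rw [if_neg]
    rintro rfl; exact H.notmem K.hm hg
  have hAD : ∀ g ∈ L, ∀ g' ∈ n :: L, ∀ t ∈ TL, g X = g' t → AD g = AD g' ++ [g X] := by
    intro g hg g' hg' t ht e
    rw [hADL g hg]
    congr 1
    rw [e]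
    have hh : t ≠ X := fun h => K.hXT (h ▸ ht)
    rcases List.mem_cons.1 hg' with rfl | hg'
    · simp [AD, hs0 t (K.hTL t ht)]
    · rw [hADL g' hg']; exact hsL g' hg' t (K.hTL t ht) hh
  have fin : ∀ s, (∀ g ∈ L, ∃ g' ∈ n :: L, ∃ t ∈ TL, g X = g' t ∧ AD g' <+: s) → brLE S 1 := by
    intro s hs
    apply br_of s
    intro w hw l hl hne
    rcases hS w hw with rfl | ⟨g, hg, rfl⟩
    · exact absurd (List.prefix_nil.1 hl) hne
    · obtain ⟨g', hg', t, ht, e, hpre⟩ := hs g hg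
      rw [← hADL g hg, hAD g hg g' hg' t ht e] at hl hne
      rcases List.prefix_concat_iff.1 hl with h | h
      · exact absurd h hne
      · exact h.trans hpre
  rcases hper with ⟨t, rfl⟩ | ⟨p, r, P⟩
  · obtain ⟨hd, _, i1, _⟩ := chain_one H AD (fun g hg g' hg' e => hAD g hg g' hg' t rfl e)
    apply fin (AD hd)
    intro g hg
    obtain ⟨g', hg', t', ht', e⟩ := H.par g hg
    exact ⟨g', hg', t', ht', e, i1 g' hg'⟩
  · obtain ⟨u, hu, huU⟩ := nec K P H hU hM
    let Q : (ℕ → ℕ) → Prop := fun g => ∃ g' ∈ n :: L, ∃ t ∈ TL, g X = g' t ∧ AD g' <+: AD u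
    let L' := L.filter (fun g => @decide (Q g) (Classical.propDecidable _))
    have memL' : ∀ g, g ∈ L' ↔ g ∈ L ∧ Q g := by
      intro g; simp [L', List.mem_filter]
    have H' : Hist m X TL n L' := by
      refine H.filter Q ?_
      rintro g hg ⟨g1, hg1, t1, ht1, e1, hp1⟩ g' hg' t ht e
      have hpre : AD g' <+: AD u := by
        have := hAD g hg g1 hg1 t1 ht1 e1
        rw [hAD g hg g' hg' t ht e] at this
        rw [List.append_cancel_right this]; exact hp1
      rcases List.mem_cons.1 hg' with h | hg'L
      · exact Or.inl h
      · right
        obtain ⟨g2, hg2, t2, ht2, e2⟩ := H.par g' hg'L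
        refine ⟨g2, hg2, t2, ht2, e2, ?_⟩
        rw [hAD g' hg'L g2 hg2 t2 ht2 e2] at hpre
        exact (List.prefix_append _ _).trans hpre
    let U' : Set ℕ := {v | v ∈ U ∧ ∃ g ∈ n :: L', ∃ t ∈ TL, v = g t}
    have hU' : U' ⊆ TN X TL n L' := by
      rintro v ⟨hv, hv2⟩
      exact ⟨hv2, fun g hg => (hU hv).2 g ((memL' g).1 hg).1⟩
    have live : ∀ g, Live X p r n L U g → AD g <+: AD u → Live X p r n L' U' g := by
      intro g hg
      induction hg with
      | root => intro _; exact Live.root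
      | step g' g i hl hg hi hir e hh ih =>
        intro hpre
        have hTi : ∀ j, 1 ≤ j → j ≤ i → X + j * p ∈ TL :=
          fun j h1 h2 => (P.hT _).2 ⟨j, h1, by omega, rfl⟩
        have hpre' : AD g' <+: AD u := by
          rw [hAD g hg g' hl.mem _ (hTi i hi le_rfl) e] at hpre
          exact (List.prefix_append _ _).trans hpre
        have hl' := ih hpre'
        refine Live.step g' g i hl' ?_ hi hir e ?_
        · exact (memL' g).2 ⟨hg, g', hl.mem, _, hTi i hi le_rfl, e, hpre'⟩
        · intro j h1 h2
          rcases hh j h1 h2 with h | ⟨g'', hg'', h⟩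
          · exact Or.inl ⟨h, g', hl'.mem, _, hTi j h1 h2, rfl⟩
          · exact Or.inr ⟨g'', (memL' g'').2 ⟨hg'', g', hl.mem, _, hTi j h1 h2, h, hpre'⟩, h⟩
    have hu' := live u hu List.prefix_rfl
    have hM' := suff K P hu' (fun t ht => ⟨huU t ht, u, hu'.mem, t, ht, rfl⟩)
    obtain ⟨S', seg', tc', hC'⟩ := to_cac' (d := d) K H' hU' hM'
    have hid : At.map id '' (cact d m X lab n L' U') = cact d m X lab n L' U' := by
      have : (At.map id : At σ ℕ → At σ ℕ) = id := by
        funext a; cases a <;> rfl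
      rw [this, Set.image_id]
    have heq := hmin _ _ _ _ hC' id Function.injective_id (by
      rw [hid]
      rintro a (⟨g, hg, i, hi, rfl⟩ | rfl | ⟨g, hg, rfl⟩ | ⟨v, hv, rfl⟩)
      · refine mem_cact_Ed.2 ⟨g, ?_, i, hi, rfl, rfl, rfl⟩
        rcases List.mem_cons.1 hg with h | h
        · simp [h]
        · simp [((memL' g).1 h).1]
      · exact mem_cact_F.2 rfl
      · exact mem_cact_A.2 ⟨g, ((memL' g).1 hg).1, rfl⟩
      · exact mem_cact_T.2 hv.1)
    rw [hid] at heq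
    apply fin (AD u)
    intro g hg
    have hA : At.A (g X) ∈ cact d m X lab n L U := mem_cact_A.2 ⟨g, hg, rfl⟩
    rw [← heq] at hA
    obtain ⟨g2, hg2, e⟩ := mem_cact_A.1 hA
    have h2 := (memL' g2).1 hg2
    rw [H.root g hg g2 h2.1 e]
    exact h2.2

end Core

/-- Let `q` be a periodic twinless path `1`-CQ (single
`F`-node `x0`, `T`-nodes `TL`) and `Q = (cov_A, q)`. Then every cactus in
`K_Q^min` has branching number at most `1`. -/
theorem statement_10 {σ : Type} (m x0 : ℕ) (ρ : ℕ → σ) (TL : Set ℕ)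
    (hm : 0 < m) (hx0 : x0 ≤ m) (hTL : TL ⊆ Set.Iic m) (hTLne : TL.Nonempty)
    (hx0TL : x0 ∉ TL)
    (hper : rightPeriodic σ m x0 ρ TL ∨ leftPeriodic σ m x0 ρ TL)
    (C : Set (At σ ℕ)) (S : Set (List ℕ)) (seg : ℕ → List ℕ) (tc : Set ℕ)
    (hC : CacP (pathCQ σ m ρ {x0} TL) x0 C S seg tc)
    (hmin : ∀ (C' : Set (At σ ℕ)) S' seg' tc',
      CacP (pathCQ σ m ρ {x0} TL) x0 C' S' seg' tc' →
      ∀ g : ℕ → ℕ, Function.Injective g → At.map g '' C' ⊆ C → At.map g '' C' = C) :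
    brLE S 1 := by
  have hfin : TL.Finite := (Set.finite_Iic m).subset hTL
  have hcard : 1 ≤ TL.ncard := (Set.ncard_pos hfin).2 hTLne
  rcases hper with ⟨hgt, hp⟩ | ⟨hlt, hp⟩
  · have hq : pathCQ σ m ρ {x0} TL = gq true m x0 ρ TL id := by
      ext a; simp [pathCQ, gq, Ed]
    rw [hq] at hC hmin
    have K : Ctx m x0 TL id := ⟨fun _ => rfl, hm, hx0, fun t ht => hTL ht, hx0TL⟩
    refine core (n := id) K ?_ hC hmin
    rcases hp with hp | ⟨p, hp0, hT, hl⟩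
    · exact Or.inl (Set.ncard_eq_one.1 hp)
    · refine Or.inr ⟨p, TL.ncard, hp0, hcard, ?_, hl⟩
      intro x
      constructor
      · intro hx; rw [hT] at hx; exact hx
      · intro hx; rw [hT]; exact hx
  · let n : ℕ → ℕ := fun i => if i ≤ m then m - i else i
    have hnle : ∀ i, i ≤ m → n i = m - i := fun i hi => if_pos hi
    have hnn : ∀ i, n (n i) = i := by
      intro i
      by_cases hi : i ≤ m
      · rw [hnle i hi, hnle _ (by omega)]; omega
      · have : n i = i := if_neg hi
        rw [this, this]
    let TL' : Set ℕ := {t | n t ∈ TL}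
    let X := m - x0
    have hnX : n X = x0 := by
      rw [hnle _ (by omega)]; omega
    have hT'm : ∀ t ∈ TL', t ≤ m := by
      intro t ht
      have h1 : n t ≤ m := hTL ht
      rw [← hnn t, hnle _ h1]; omega
    have K : Ctx m X TL' n := by
      refine ⟨hnn, hm, by omega, hT'm, ?_⟩
      intro h
      apply hx0TL
      rw [← hnX]; exact h
    have hq : pathCQ σ m ρ {x0} TL = gq false m X (fun i => ρ (m - 1 - i)) TL' n := by
      ext a
      constructor
      · rintro (⟨i, hi, rfl⟩ | ⟨i, rfl, rfl⟩ | ⟨i, hi, rfl⟩)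
        · refine Or.inl ⟨m - 1 - i, by omega, ?_⟩
          simp only [Ed]
          rw [hnle _ (by omega), hnle _ (by omega), show m - 1 - (m - 1 - i) = i by omega,
            show m - (m - 1 - i + 1) = i by omega, show m - (m - 1 - i) = i + 1 by omega]
          simp
        · exact Or.inr (Or.inl (by rw [hnX]))
        · refine Or.inr (Or.inr ⟨n i, ?_, by rw [hnn]⟩)
          change n (n i) ∈ TL
          rw [hnn]; exact hi
      · rintro (⟨i, hi, rfl⟩ | rfl | ⟨t, ht, rfl⟩)
        · refine Or.inl ⟨m - 1 - i, by omega, ?_⟩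
          simp only [Ed]
          rw [hnle _ (by omega), hnle _ (by omega), show m - (i + 1) = m - 1 - i by omega,
            show m - i = m - 1 - i + 1 by omega]
          simp
        · exact Or.inr (Or.inl ⟨x0, rfl, by rw [hnX]⟩)
        · exact Or.inr (Or.inr ⟨n t, ht, rfl⟩)
    have hC' : CacP (gq false m X (fun i => ρ (m - 1 - i)) TL' n) (n X) C S seg tc := by
      rw [← hq, hnX]; exact hC
    refine core (n := n) K ?_ hC' (by rw [← hq, hnX]; exact hmin)
    rcases hp with hp | ⟨p, hp0, hT, hl⟩
    · left
      obtain ⟨t, ht⟩ := Set.ncard_eq_one.1 hp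
      refine ⟨n t, ?_⟩
      ext x
      change n x ∈ TL ↔ x = n t
      rw [ht, Set.mem_singleton_iff]
      constructor
      · intro h; rw [← h, hnn]
      · intro h; rw [h, hnn]
    · right
      refine ⟨p, TL.ncard, hp0, hcard, ?_, ?_⟩
      · have hT2 : ∀ x, x ∈ TL ↔ ∃ k, 1 ≤ k ∧ k ≤ TL.ncard ∧ x + k * p = x0 := by
          intro x
          constructor
          · intro hx; rw [hT] at hx; exact hx
          · intro hx; rw [hT]; exact hx
        intro x
        constructor
        · intro hx
          have hxm := hT'm x hx
          obtain ⟨k, h1, h2, h3⟩ := (hT2 _).1 (show n x ∈ TL from hx)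
          rw [hnle x hxm] at h3
          exact ⟨k, h1, h2, by omega⟩
        · rintro ⟨k, h1, h2, h3⟩
          change n x ∈ TL
          have hk : TL.ncard * p ≤ x0 := by
            have hne : ∃ y, y + TL.ncard * p = x0 := by
              by_contra hcon
              have hsub : TL ⊆ (fun k => x0 - k * p) '' (Set.Icc 1 (TL.ncard - 1)) := by
                intro y hy
                obtain ⟨k, a1, a2, a3⟩ := (hT2 y).1 hy
                refine ⟨k, ⟨a1, ?_⟩, by dsimp only; omega⟩
                by_contra hc2
                have : k = TL.ncard := by omega
                subst this
                exact hcon ⟨y, a3⟩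
              have c1 := Set.ncard_le_ncard hsub ((Set.finite_Icc _ _).image _)
              have c2 := Set.ncard_image_le (f := fun k => x0 - k * p)
                (Set.finite_Icc 1 (TL.ncard - 1))
              rw [← Nat.card_coe_set_eq (Set.Icc _ _)] at c2
              simp at c2
              omega
            obtain ⟨y, hy⟩ := hne
            omega
          have := Nat.mul_le_mul_right p h2
          rw [hT2, hnle x (by omega)]
          exact ⟨k, h1, h2, by omega⟩
      · intro i hi him
        have := hl (m - 1 - (i + p)) (by omega)
        rw [show m - 1 - (i + p) + p = m - 1 - i by omega] at this
        exact this.symm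

end DS
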